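/- (Corollary: robust linear constraint reformulation.) Let e_i ∈ ℝ^{p_i} × ℝ^{p_i−1} for i = 1,…,n and m ∈ ℝ. Then Σ_{i=1}^n e_i·G_i(ξ_i) ≤ m for every ξ ∈ Ξ if and only if there exist reals m_1,…,m_n such that m ≥ Σ_{i=1}^n m_i and, for every i ∈ [n] and j ∈ [p_i], both m_i ≥ e_i·φ⁻_{i,j} and m_i ≥ e_i·φ_{i,j−1}. -/

import Mathlib

/-- The breakpoints are increasing up to the last one. -/
lemma breakpoints_mono {p : ℕ} {w : ℕ → ℝ} (hw : ∀ j < p, w j < w (j + 1)) {a b : ℕ}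
    (hab : a ≤ b) (hb : b ≤ p) : w a ≤ w b := by
  induction b, hab using Nat.le_induction with
  | base => exact le_rfl
  | succ k _ ih => exact (ih (by omega)).trans (hw k (by omega)).le

/-- On the piece `[w j, w (j + 1)]` each coordinate of the continuous part is affine. -/
lemma lift_coord_affine {p : ℕ} {w : ℕ → ℝ} (hw : ∀ j < p, w j < w (j + 1))
    {V : ℕ → ℝ → ℝ} (hV1 : ∀ x, V 1 x = min x (w 1))
    (hVj : ∀ j, 2 ≤ j → ∀ x, V j x = max (min x (w j) - w (j - 1)) 0)
    {j k : ℕ} (hj : j < p) (hk : 1 ≤ k) (hkp : k ≤ p) {t : ℝ} (ht0 : 0 ≤ t) (ht1 : t ≤ 1) :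
    V k ((1 - t) * w (j + 1) + t * w j) = (1 - t) * V k (w (j + 1)) + t * V k (w j) := by
  have hlt := hw j hj
  have hx1 : w j ≤ (1 - t) * w (j + 1) + t * w j := by nlinarith
  have hx2 : (1 - t) * w (j + 1) + t * w j ≤ w (j + 1) := by nlinarith
  set x := (1 - t) * w (j + 1) + t * w j with hx
  rcases hk.eq_or_lt with rfl | hk2
  · simp only [hV1]
    rcases Nat.eq_zero_or_pos j with rfl | hj0
    · rw [min_eq_left hx2, min_eq_left le_rfl, min_eq_left hlt.le]
    · have h1 : w 1 ≤ w j := breakpoints_mono hw hj0 hj.le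
      rw [min_eq_right (h1.trans hx1), min_eq_right (h1.trans hlt.le), min_eq_right h1]
      ring
  · simp only [hVj k hk2]
    rcases lt_trichotomy k (j + 1) with h | rfl | h
    · have h1 : w k ≤ w j := breakpoints_mono hw (by omega) hj.le
      rw [min_eq_right (h1.trans hx1), min_eq_right (h1.trans hlt.le), min_eq_right h1]
      ring
    · rw [Nat.add_sub_cancel, min_eq_left hx2, min_eq_left le_rfl, min_eq_left hlt.le,
        max_eq_left (by linarith), max_eq_left (by linarith), max_eq_left (by linarith), hx]
      ring
    · have h1 : w (j + 1) ≤ w (k - 1) := breakpoints_mono hw (by omega) (by omega)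
      have h0 : ∀ y ≤ w (j + 1), max (min y (w k) - w (k - 1)) 0 = 0 := fun y hy =>
        max_eq_right (by linarith [min_le_left y (w k)])
      rw [h0 _ hx2, h0 _ le_rfl, h0 _ hlt.le]
      ring

/-- Away from its right end, the lifted linear functional on a piece interpolates between the
left limit at the right end and the value at the left end. -/
lemma lift_affine {p : ℕ} {w : ℕ → ℝ} (hw : ∀ j < p, w j < w (j + 1))
    {V : ℕ → ℝ → ℝ} (hV1 : ∀ x, V 1 x = min x (w 1))
    (hVj : ∀ j, 2 ≤ j → ∀ x, V j x = max (min x (w j) - w (j - 1)) 0)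
    {Q : ℕ → ℝ → ℝ} (hQ : ∀ j x, Q j x = if w j ≤ x then 1 else 0)
    {eV eQ : ℕ → ℝ} {g : ℝ → ℝ}
    (hg : ∀ x, g x = (∑ j ∈ Finset.Icc 1 p, eV j * V j x)
        + ∑ j ∈ Finset.Icc 1 (p - 1), eQ j * Q j x)
    {gm : ℕ → ℝ}
    (hgm : ∀ j, gm j = (∑ k ∈ Finset.Icc 1 p, eV k * V k (w j))
        + ∑ k ∈ Finset.Icc 1 (p - 1), eQ k * (if k < j then 1 else 0))
    {j : ℕ} (hj : j < p) {t : ℝ} (ht0 : 0 < t) (ht1 : t ≤ 1) :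
    g ((1 - t) * w (j + 1) + t * w j) = (1 - t) * gm (j + 1) + t * g (w j) := by
  have hlt := hw j hj
  have step : ∀ x, w j ≤ x → x < w (j + 1) → ∀ k ∈ Finset.Icc 1 (p - 1),
      Q k x = if k < j + 1 then 1 else 0 := by
    intro x h1 h2 k hk
    rw [Finset.mem_Icc] at hk
    rw [hQ]
    refine if_congr ⟨fun h => ?_, fun h => ?_⟩ rfl rfl
    · by_contra hc
      linarith [breakpoints_mono hw (show j + 1 ≤ k by omega) (by omega)]
    · exact (breakpoints_mono hw (by omega) hj.le).trans h1
  have hx1 : w j ≤ (1 - t) * w (j + 1) + t * w j := by nlinarith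
  have hx2 : (1 - t) * w (j + 1) + t * w j < w (j + 1) := by nlinarith
  have hQsum : ∀ x, w j ≤ x → x < w (j + 1) → ∑ k ∈ Finset.Icc 1 (p - 1), eQ k * Q k x
      = ∑ k ∈ Finset.Icc 1 (p - 1), eQ k * (if k < j + 1 then 1 else 0) :=
    fun x h1 h2 => Finset.sum_congr rfl fun k hk => by rw [step x h1 h2 k hk]
  have hVsum : ∑ k ∈ Finset.Icc 1 p, eV k * V k ((1 - t) * w (j + 1) + t * w j)
      = (1 - t) * ∑ k ∈ Finset.Icc 1 p, eV k * V k (w (j + 1))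
        + t * ∑ k ∈ Finset.Icc 1 p, eV k * V k (w j) := by
    rw [Finset.mul_sum, Finset.mul_sum, ← Finset.sum_add_distrib]
    refine Finset.sum_congr rfl fun k hk => ?_
    rw [Finset.mem_Icc] at hk
    rw [lift_coord_affine hw hV1 hVj hj hk.1 hk.2 ht0.le ht1]
    ring
  rw [hg, hg, hgm, hQsum _ hx1 hx2, hQsum _ le_rfl hlt, hVsum]
  ring

/-- At the last breakpoint the lifting map is left continuous. -/
lemma lift_last {p : ℕ} {w : ℕ → ℝ} (hw : ∀ j < p, w j < w (j + 1))
    {V Q : ℕ → ℝ → ℝ} (hQ : ∀ j x, Q j x = if w j ≤ x then 1 else 0)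
    {eV eQ : ℕ → ℝ} {g : ℝ → ℝ}
    (hg : ∀ x, g x = (∑ j ∈ Finset.Icc 1 p, eV j * V j x)
        + ∑ j ∈ Finset.Icc 1 (p - 1), eQ j * Q j x)
    {gm : ℕ → ℝ}
    (hgm : ∀ j, gm j = (∑ k ∈ Finset.Icc 1 p, eV k * V k (w j))
        + ∑ k ∈ Finset.Icc 1 (p - 1), eQ k * (if k < j then 1 else 0)) :
    g (w p) = gm p := by
  rw [hg, hgm]
  congr 1
  refine Finset.sum_congr rfl fun k hk => ?_
  rw [Finset.mem_Icc] at hk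
  rw [hQ, if_pos (breakpoints_mono hw (by omega) le_rfl), if_pos (by omega)]

/-- A point between the first and the last breakpoint is the last one or lies in a half-open
piece. -/
lemma exists_piece {w : ℕ → ℝ} {x : ℝ} (h0 : w 0 ≤ x) {p : ℕ} (hx : x ≤ w p) :
    x = w p ∨ ∃ j < p, w j ≤ x ∧ x < w (j + 1) := by
  induction p with
  | zero => exact Or.inl (le_antisymm hx h0)
  | succ k ih =>
    rcases hx.eq_or_lt with h | h
    · exact Or.inl h
    · rcases le_total (w k) x with hk | hk
      · exact Or.inr ⟨k, by omega, hk, h⟩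
      · rcases ih hk with rfl | ⟨j, hj, hj'⟩
        · exact Or.inr ⟨k, by omega, le_rfl, h⟩
        · exact Or.inr ⟨j, by omega, hj'⟩

/-- If `(1 - t) * a + t * b ≤ M` for all `t ∈ (0, 1]`, then `a ≤ M`. -/
lemma le_of_forall_interp_le {a b M : ℝ}
    (h : ∀ t : ℝ, 0 < t → t ≤ 1 → (1 - t) * a + t * b ≤ M) : a ≤ M := by
  have hlim : Filter.Tendsto (fun t : ℝ => (1 - t) * a + t * b) (nhdsWithin 0 (Set.Ioi 0))
      (nhds a) := by
    have hc : Continuous fun t : ℝ => (1 - t) * a + t * b := by fun_prop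
    simpa using (hc.tendsto 0).mono_left nhdsWithin_le_nhds
  refine le_of_tendsto hlim ?_
  filter_upwards [Ioc_mem_nhdsGT (zero_lt_one' ℝ)] with t ht using h t ht.1 ht.2

/-- A function on `[w 0, w p]` that interpolates on every piece is bounded by `M` exactly when
its end values on all pieces are. -/
lemma forall_le_iff_vertices_le {p : ℕ} (hp : 1 ≤ p) {w : ℕ → ℝ}
    (hw : ∀ j < p, w j < w (j + 1)) {g : ℝ → ℝ} {gm : ℕ → ℝ}
    (haff : ∀ j < p, ∀ t : ℝ, 0 < t → t ≤ 1 →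
      g ((1 - t) * w (j + 1) + t * w j) = (1 - t) * gm (j + 1) + t * g (w j))
    (hlast : g (w p) = gm p) (M : ℝ) :
    (∀ x ∈ Set.Icc (w 0) (w p), g x ≤ M) ↔
      ∀ j, 1 ≤ j → j ≤ p → gm j ≤ M ∧ g (w (j - 1)) ≤ M := by
  constructor
  · intro h j hj1 hjp
    obtain ⟨k, rfl⟩ : ∃ k, j = k + 1 := ⟨j - 1, by omega⟩
    have h0 : w 0 ≤ w k := breakpoints_mono hw (by omega) (by omega)
    have h1 : w (k + 1) ≤ w p := breakpoints_mono hw hjp le_rfl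
    have hlt := hw k (by omega)
    refine ⟨le_of_forall_interp_le (b := g (w k)) fun t ht0 ht1 => ?_,
      h _ ⟨h0, hlt.le.trans h1⟩⟩
    rw [← haff k (by omega) t ht0 ht1]
    exact h _ ⟨by nlinarith, by nlinarith⟩
  · rintro h x ⟨hx0, hxp⟩
    rcases exists_piece hx0 hxp with rfl | ⟨j, hj, hjx, hxj⟩
    · rw [hlast]
      exact (h p hp le_rfl).1
    · have hd : 0 < w (j + 1) - w j := by linarith
      have ht0 : 0 < (w (j + 1) - x) / (w (j + 1) - w j) := div_pos (by linarith) hd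
      have ht1 : (w (j + 1) - x) / (w (j + 1) - w j) ≤ 1 := (div_le_one hd).2 (by linarith)
      have hx : x = (1 - (w (j + 1) - x) / (w (j + 1) - w j)) * w (j + 1)
          + (w (j + 1) - x) / (w (j + 1) - w j) * w j := by
        field_simp
        ring
      obtain ⟨ha, hb⟩ := h (j + 1) (by omega) hj
      rw [Nat.add_sub_cancel] at hb
      rw [hx, haff j hj _ ht0 ht1]
      nlinarith

/-- A separable sum is bounded by `m` on a product of nonempty sets iff `m` splits into bounds of
the summands, provided each summand is bounded above. -/
lemma forall_sum_le_iff_exists_bounds {ι : Type*} [Fintype ι] {α : ι → Type*}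
    {s : ∀ i, Set (α i)} (hs : ∀ i, (s i).Nonempty) {f : ∀ i, α i → ℝ}
    (hf : ∀ i, ∃ M, ∀ x ∈ s i, f i x ≤ M) (m : ℝ) :
    (∀ ξ ∈ Set.univ.pi s, ∑ i, f i (ξ i) ≤ m) ↔
      ∃ mi : ι → ℝ, ∑ i, mi i ≤ m ∧ ∀ i, ∀ x ∈ s i, f i x ≤ mi i := by
  constructor
  · intro h
    have hbdd : ∀ i, BddAbove (f i '' s i) := fun i => by
      obtain ⟨M, hM⟩ := hf i
      exact ⟨M, by rintro _ ⟨x, hx, rfl⟩; exact hM x hx⟩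
    refine ⟨fun i => sSup (f i '' s i), ?_,
      fun i x hx => le_csSup (hbdd i) (Set.mem_image_of_mem _ hx)⟩
    have key : ∀ t : ℝ, 0 < t → t ≤ 1 →
        (1 - t) * ∑ i, sSup (f i '' s i)
          + t * (∑ i, sSup (f i '' s i) - Fintype.card ι) ≤ m := by
      intro t ht0 _
      have hex : ∀ i, ∃ x ∈ s i, sSup (f i '' s i) - t < f i x := fun i => by
        obtain ⟨_, ⟨x, hx, rfl⟩, hlt⟩ :=
          exists_lt_of_lt_csSup ((hs i).image (f i)) (sub_lt_self (sSup (f i '' s i)) ht0)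
        exact ⟨x, hx, hlt⟩
      choose ξ hξ hlt using hex
      have hsum := (Finset.sum_le_sum fun i (_ : i ∈ Finset.univ) => (hlt i).le).trans
        (h ξ fun i _ => hξ i)
      rw [Finset.sum_sub_distrib, Finset.sum_const, Finset.card_univ, nsmul_eq_mul] at hsum
      linarith
    exact le_of_forall_interp_le key
  · rintro ⟨mi, hm, hle⟩ ξ hξ
    exact (Finset.sum_le_sum fun i _ => hle i _ (hξ i (Set.mem_univ i))).trans hm


/-- **Corollary: robust linear constraint reformulation.** For coefficient
vectors `eᵢ` (written through `eV i j`, `eQ i j`), the robust constraint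
`Σᵢ eᵢ·Gᵢ(ξᵢ) ≤ m` for all `ξ ∈ Ξ` holds iff there exist reals `m₁,…,mₙ` with
`Σᵢ mᵢ ≤ m` and, for every `i` and `j ∈ [1, pᵢ]`, both `eᵢ·φ⁻_{i,j} ≤ mᵢ` and
`eᵢ·φ_{i,j−1} ≤ mᵢ`. -/
theorem stmt_7 (n : ℕ)
    (p : Fin n → ℕ) (hp : ∀ i, 1 ≤ p i)
    (w : Fin n → ℕ → ℝ) (hw : ∀ i, ∀ j < p i, w i j < w i (j + 1))
    (V : Fin n → ℕ → ℝ → ℝ)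
    (hV1 : ∀ i (x : ℝ), V i 1 x = min x (w i 1))
    (hVj : ∀ i j, 2 ≤ j → ∀ x : ℝ, V i j x = max (min x (w i j) - w i (j - 1)) 0)
    (Q : Fin n → ℕ → ℝ → ℝ)
    (hQ : ∀ i j (x : ℝ), Q i j x = if w i j ≤ x then 1 else 0)
    (eV eQ : Fin n → ℕ → ℝ) (m : ℝ)
    (dG : Fin n → ℝ → ℝ)
    (hdG : ∀ i (x : ℝ), dG i x = (∑ j ∈ Finset.Icc 1 (p i), eV i j * V i j x)
        + ∑ j ∈ Finset.Icc 1 (p i - 1), eQ i j * Q i j x)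
    (dφ : Fin n → ℕ → ℝ) (hdφ : ∀ i j, dφ i j = dG i (w i j))
    (dφm : Fin n → ℕ → ℝ)
    (hdφm : ∀ i j, dφm i j = (∑ k ∈ Finset.Icc 1 (p i), eV i k * V i k (w i j))
        + ∑ k ∈ Finset.Icc 1 (p i - 1), eQ i k * (if k < j then 1 else 0)) :
    (∀ ξ ∈ Set.univ.pi fun i => Set.Icc (w i 0) (w i (p i)), (∑ i, dG i (ξ i)) ≤ m)
    ↔ ∃ mi : Fin n → ℝ, (∑ i, mi i) ≤ m
        ∧ ∀ i, ∀ j, 1 ≤ j → j ≤ p i → dφm i j ≤ mi i ∧ dφ i (j - 1) ≤ mi i := by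
  have hone : ∀ i M, (∀ x ∈ Set.Icc (w i 0) (w i (p i)), dG i x ≤ M) ↔
      ∀ j, 1 ≤ j → j ≤ p i → dφm i j ≤ M ∧ dφ i (j - 1) ≤ M := fun i M => by
    simp only [hdφ]
    exact forall_le_iff_vertices_le (hp i) (hw i)
      (fun j hj t ht0 ht1 =>
        lift_affine (hw i) (hV1 i) (hVj i) (hQ i) (hdG i) (hdφm i) hj ht0 ht1)
      (lift_last (hw i) (hQ i) (hdG i) (hdφm i)) M
  have hbdd : ∀ i, ∃ M, ∀ x ∈ Set.Icc (w i 0) (w i (p i)), dG i x ≤ M := fun i => by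
    obtain ⟨M, hM⟩ := ((Finset.Icc 1 (p i)).image
      fun j => max (dφm i j) (dφ i (j - 1))).bddAbove
    refine ⟨M, (hone i M).2 fun j hj1 hjp => max_le_iff.1 (hM ?_)⟩
    exact Finset.mem_coe.2 (Finset.mem_image_of_mem _ (Finset.mem_Icc.2 ⟨hj1, hjp⟩))
  rw [forall_sum_le_iff_exists_bounds
    (fun i => Set.nonempty_Icc.2 (breakpoints_mono (hw i) (Nat.zero_le _) le_rfl)) hbdd]
  simp only [hone]
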